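/- Let $W$ be a vector space over a field, $S \subseteq W^{\otimes N}$ a subspace, and suppose the orthogonal-complement condition holds: for all $2 \leq m \leq N-1$, $(V^{\otimes m} \otimes R) \cap (R \otimes V^{\otimes m} + V \otimes R \otimes V^{\otimes m-1} + \cdots + V^{\otimes m-1} \otimes R \otimes V) \subseteq V^{\otimes m-1} \otimes R \otimes V$, where $R \subseteq V^{\otimes N}$ is the annihilator of $S$ under the duality $V = W^*$. Then for $m = 2, 3, \ldots, N-1$: $W^{\otimes m-1} \otimes S \otimes W \subseteq W^{\otimes m} \otimes S + \bigcap_{i=1}^{m} (W^{\otimes m-i} \otimes S \otimes W^{\otimes i})$. -/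

import Mathlib

open scoped TensorProduct
open PiTensorProduct

namespace PBW16

variable (k : Type) [Field k]

/-- The product pairing `W^{⊗n} → (V^{⊗n})^*` for `W = V^*`, determined by
`(f₁ ⊗ ⋯ ⊗ f_n)(x₁ ⊗ ⋯ ⊗ x_n) = ∏ f_i(x_i)`. -/
noncomputable def pairing (V : Type) [AddCommGroup V] [Module k V] (n : ℕ) :
    (⨂[k]^n (V →ₗ[k] k)) →ₗ[k] ((⨂[k]^n V) →ₗ[k] k) :=
  (LinearMap.llcomp k (⨂[k]^n V) (⨂[k]^n k) k
      (PiTensorProduct.lift (MultilinearMap.mkPiAlgebra k (Fin n) k))).comp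
    PiTensorProduct.piTensorHomMap

/-- The annihilator `R = S^⊥ ⊆ V^{⊗N}` of a subspace `S ⊆ W^{⊗N}`, `W = V^*`. -/
noncomputable def annih (V : Type) [AddCommGroup V] [Module k V] (N : ℕ)
    (S : Submodule k (⨂[k]^N (V →ₗ[k] k))) : Submodule k (⨂[k]^N V) :=
  ⨅ s ∈ S, LinearMap.ker (pairing k V N s)

/-- The graded multiplication (concatenation) `M^{⊗a} ⊗ M^{⊗b} → M^{⊗(a+b)}`. -/
noncomputable def gmul (M : Type) [AddCommGroup M] [Module k M] {a b : ℕ}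
    (x : ⨂[k]^a M) (y : ⨂[k]^b M) : ⨂[k]^(a + b) M :=
  @GradedMonoid.GMul.mul ℕ (fun i => ⨂[k]^i M) _ _ a b x y

/-- The subspace `M^{⊗a} ⊗ S ⊗ M^{⊗b}` of `M^{⊗(a+n+b)}`, for `S ⊆ M^{⊗n}`. -/
noncomputable def sand (M : Type) [AddCommGroup M] [Module k M] (a : ℕ) {n : ℕ}
    (S : Submodule k (⨂[k]^n M)) (b : ℕ) : Submodule k (⨂[k]^(a + n + b) M) :=
  Submodule.span k
    {z | ∃ (u : Fin a → M) (w : Fin b → M), ∃ r ∈ S,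
      z = gmul k M (gmul k M (tprod k u) r) (tprod k w)}

/-- The concatenation product as a bilinear map. -/
noncomputable def gmulB (M : Type) [AddCommGroup M] [Module k M] (a b : ℕ) :
    (⨂[k]^a M) →ₗ[k] (⨂[k]^b M) →ₗ[k] (⨂[k]^(a + b) M) :=
  (TensorProduct.mk k _ _).compr₂ (TensorPower.mulEquiv (R := k) (M := M)).toLinearMap

theorem gmul_eq (M : Type) [AddCommGroup M] [Module k M] {a b : ℕ}
    (x : ⨂[k]^a M) (y : ⨂[k]^b M) : gmul k M x y = gmulB k M a b x y := rfl

theorem gmulB_tprod (M : Type) [AddCommGroup M] [Module k M] {a b : ℕ}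
    (x : Fin a → M) (y : Fin b → M) :
    gmulB k M a b (tprod k x) (tprod k y) = tprod k (Fin.append x y) :=
  TensorPower.tprod_mul_tprod k x y

theorem pairing_tprod (V : Type) [AddCommGroup V] [Module k V] (n : ℕ)
    (f : Fin n → (V →ₗ[k] k)) (x : Fin n → V) :
    pairing k V n (tprod k f) (tprod k x) = ∏ i, f i (x i) := by
  simp only [pairing, LinearMap.comp_apply, LinearMap.llcomp_apply, piTensorHomMap_tprod_tprod,
    lift.tprod, MultilinearMap.mkPiAlgebra_apply]

theorem pairing_gmulB (V : Type) [AddCommGroup V] [Module k V] (a b : ℕ)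
    (s : ⨂[k]^a (V →ₗ[k] k)) (t : ⨂[k]^b (V →ₗ[k] k)) (x : ⨂[k]^a V) (y : ⨂[k]^b V) :
    pairing k V (a + b) (gmulB k _ a b s t) (gmulB k V a b x y) =
      pairing k V a s x * pairing k V b t y := by
  induction s using PiTensorProduct.induction_on with
  | add s s' h h' => simp only [map_add, LinearMap.add_apply, h, h', add_mul]
  | smul_tprod c s =>
  induction t using PiTensorProduct.induction_on with
  | add s s' h h' => simp only [map_add, LinearMap.add_apply, h, h', mul_add]
  | smul_tprod d t =>
  induction x using PiTensorProduct.induction_on with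
  | add s s' h h' => simp only [map_add, LinearMap.add_apply, h, h', add_mul]
  | smul_tprod e x =>
  induction y using PiTensorProduct.induction_on with
  | add s s' h h' => simp only [map_add, h, h', mul_add]
  | smul_tprod f y =>
  simp only [map_smul, LinearMap.smul_apply, gmulB_tprod, pairing_tprod, Fin.prod_univ_add,
    Fin.append_left, Fin.append_right, smul_eq_mul]
  ring

/-- Index-wise basis of a tensor power. -/
noncomputable abbrev tb {M : Type} [AddCommGroup M] [Module k M] {ι : Type}
    (e : Module.Basis ι k M) (n : ℕ) : Module.Basis (Fin n → ι) k (⨂[k]^n M) :=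
  Basis.piTensorProduct (fun _ : Fin n => e)

theorem pairing_tb (V : Type) [AddCommGroup V] [Module k V] {ι : Type} [Fintype ι]
    [DecidableEq ι] (e : Module.Basis ι k V) (n : ℕ) (p q : Fin n → ι) :
    pairing k V n (tprod k (fun i => e.coord (p i))) (tb k e n q) = if p = q then 1 else 0 := by
  rw [Basis.piTensorProduct_apply, pairing_tprod]
  simp only [Module.Basis.coord_apply, Module.Basis.repr_self, Finsupp.single_apply]
  rw [Fintype.prod_ite_zero]
  simp [funext_iff, eq_comm]

theorem pairing_bijective (V : Type) [AddCommGroup V] [Module k V] [FiniteDimensional k V]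
    (n : ℕ) : Function.Bijective (pairing k V n) := by
  classical
  let e := Module.finBasis k V
  let B := tb k e n
  let D := tb k e.dualBasis n
  have h : ∀ p, pairing k V n (D p) = B.dualBasis p := by
    intro p
    refine B.ext fun q => ?_
    have := pairing_tb k V e n p q
    rw [Module.Basis.dualBasis_apply_self]
    rw [show D p = tprod k (fun i => e.coord (p i)) by simp [D, tb], this]
    simp [eq_comm]
  have : pairing k V n = (D.equiv B.dualBasis (Equiv.refl _)).toLinearMap := by
    refine D.ext fun p => ?_
    simp [h]
  rw [this]
  exact (D.equiv B.dualBasis (Equiv.refl _)).bijective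

theorem mem_annih (V : Type) [AddCommGroup V] [Module k V] (N : ℕ)
    (S : Submodule k (⨂[k]^N (V →ₗ[k] k))) (x : ⨂[k]^N V) :
    x ∈ annih k V N S ↔ ∀ s ∈ S, pairing k V N s x = 0 := by
  simp [annih, Submodule.mem_iInf]

/-- The annihilator as an order anti-isomorphism. -/
theorem exists_orderIso (V : Type) [AddCommGroup V] [Module k V] [FiniteDimensional k V]
    (n : ℕ) : ∃ Φ : Submodule k (⨂[k]^n (V →ₗ[k] k)) ≃o (Submodule k (⨂[k]^n V))ᵒᵈ,
      ∀ S, Φ S = OrderDual.toDual (annih k V n S) := by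
  haveI : FiniteDimensional k (⨂[k]^n V) :=
    Module.Basis.finiteDimensional_of_finite (tb k (Module.finBasis k V) n)
  let P := LinearEquiv.ofBijective (pairing k V n) (pairing_bijective k V n)
  refine ⟨(Submodule.orderIsoMapComap P).trans
    (Subspace.orderIsoFiniteDimensional (K := k) (V := ⨂[k]^n V)).dual.symm, fun S => ?_⟩
  have : (S.map (pairing k V n)).dualCoannihilator = annih k V n S := by
    ext x
    simp [mem_annih, Submodule.mem_dualCoannihilator]
  exact congrArg OrderDual.toDual this

theorem decomp (V : Type) [AddCommGroup V] [Module k V] {ι : Type} [Fintype ι]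
    (e : Module.Basis ι k V) (a N b : ℕ) (x : ⨂[k]^(a + N + b) V) :
    ∃ y : (Fin a → ι) → (Fin b → ι) → ⨂[k]^N V,
      x = ∑ u, ∑ w, gmulB k V (a + N) b (gmulB k V a N (tb k e a u) (y u w)) (tb k e b w) := by
  classical
  induction x using PiTensorProduct.induction_on with
  | add x x' h h' =>
    obtain ⟨y, rfl⟩ := h
    obtain ⟨y', rfl⟩ := h'
    refine ⟨y + y', ?_⟩
    simp only [Pi.add_apply, map_add, LinearMap.add_apply, Finset.sum_add_distrib]
  | smul_tprod t f =>
    obtain ⟨g, r, rfl⟩ : ∃ (g : Fin (a + N) → V) (r : Fin b → V), f = Fin.append g r :=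
      ⟨_, _, (Fin.append_castAdd_natAdd).symm⟩
    obtain ⟨p, q, rfl⟩ : ∃ (p : Fin a → V) (q : Fin N → V), g = Fin.append p q :=
      ⟨_, _, (Fin.append_castAdd_natAdd).symm⟩
    refine ⟨fun u w => ((tb k e a).repr (tprod k p) u * (tb k e b).repr (tprod k r) w) •
      (t • tprod k q), ?_⟩
    rw [← gmulB_tprod, ← gmulB_tprod]
    conv_lhs => rw [← (tb k e a).sum_repr (tprod k p), ← (tb k e b).sum_repr (tprod k r)]
    simp only [map_sum, map_smul, LinearMap.sum_apply, LinearMap.smul_apply, Finset.smul_sum,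
      smul_smul]
    rw [Finset.sum_comm]
    refine Finset.sum_congr rfl fun u _ => Finset.sum_congr rfl fun w _ => ?_
    congr 1
    ring

theorem annih_sand (V : Type) [AddCommGroup V] [Module k V] [FiniteDimensional k V]
    (a N b : ℕ) (S : Submodule k (⨂[k]^N (V →ₗ[k] k))) :
    annih k V (a + N + b) (sand k (V →ₗ[k] k) a S b) = sand k V a (annih k V N S) b := by
  classical
  apply le_antisymm
  · intro x hx
    rw [mem_annih] at hx
    let e := Module.finBasis k V
    obtain ⟨y, rfl⟩ := decomp k V e a N b x
    refine Submodule.sum_mem _ fun u _ => Submodule.sum_mem _ fun w _ => ?_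
    refine Submodule.subset_span ⟨fun i => e (u i), fun i => e (w i), y u w, ?_, ?_⟩
    · rw [mem_annih]
      intro s hs
      have := hx (gmulB k _ (a + N) b (gmulB k _ a N (tprod k (fun i => e.coord (u i))) s)
        (tprod k (fun i => e.coord (w i)))) (Submodule.subset_span ⟨_, _, s, hs, rfl⟩)
      simp only [map_sum, pairing_gmulB, pairing_tb] at this
      simpa using this
    · rw [gmul_eq, gmul_eq, Basis.piTensorProduct_apply, Basis.piTensorProduct_apply]
  · refine Submodule.span_le.2 ?_
    rintro _ ⟨u, w, r, hr, rfl⟩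
    rw [SetLike.mem_coe, mem_annih]
    intro s hs
    induction hs using Submodule.span_induction with
    | mem s h =>
      obtain ⟨u', w', s, hs, rfl⟩ := h
      simp only [gmul_eq, pairing_gmulB]
      rw [(mem_annih k V N S r).1 hr s hs]
      simp
    | zero => simp
    | add s t _ _ h h' => simp [h, h']
    | smul c s _ h => simp [h]

theorem annih_cast_sand (V : Type) [AddCommGroup V] [Module k V] [FiniteDimensional k V]
    (a N b n : ℕ) (h : a + N + b = n) (S : Submodule k (⨂[k]^N (V →ₗ[k] k))) :
    annih k V n (Submodule.map (TensorPower.cast k (V →ₗ[k] k) h).toLinearMap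
      (sand k (V →ₗ[k] k) a S b)) =
    Submodule.map (TensorPower.cast k V h).toLinearMap (sand k V a (annih k V N S) b) := by
  subst h
  rw [TensorPower.cast_refl, TensorPower.cast_refl]
  simp only [LinearEquiv.refl_toLinearMap, Submodule.map_id]
  exact annih_sand k V a N b S

theorem cast_sand_congr (V : Type) [AddCommGroup V] [Module k V] (N n a b a' b' : ℕ)
    (R : Submodule k (⨂[k]^N V)) (h : a + N + b = n) (h' : a' + N + b' = n)
    (ha : a = a') (hb : b = b') :
    Submodule.map (TensorPower.cast k V h).toLinearMap (sand k V a R b) =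
    Submodule.map (TensorPower.cast k V h').toLinearMap (sand k V a' R b') := by
  subst ha hb
  rfl

/-- Let `V`, `W = V^*` be dual finite-dimensional vector spaces,
`S ⊆ W^{⊗N}` a subspace and `R ⊆ V^{⊗N}` its annihilator.  Suppose Berger's distributivity
condition holds: for all `2 ≤ m ≤ N - 1`,
`(V^{⊗m} ⊗ R) ∩ (R ⊗ V^{⊗m} + V ⊗ R ⊗ V^{⊗(m-1)} + ⋯ + V^{⊗(m-1)} ⊗ R ⊗ V)
  ⊆ V^{⊗(m-1)} ⊗ R ⊗ V`.
Then for all `2 ≤ m ≤ N - 1`: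
`W^{⊗(m-1)} ⊗ S ⊗ W ⊆ W^{⊗m} ⊗ S + ⋂_{i=1}^m W^{⊗(m-i)} ⊗ S ⊗ W^{⊗i}`.
(All subspaces are compared inside `·^{⊗(m+N)}` via the canonical reindexing
isomorphisms of tensor powers.) -/
theorem stmt16 (V : Type) [AddCommGroup V] [Module k V] [FiniteDimensional k V]
    (N : ℕ) (hN : 2 ≤ N) (S : Submodule k (⨂[k]^N (V →ₗ[k] k)))
    (hyp : ∀ (m : ℕ) (h2 : 2 ≤ m) (hm : m + 1 ≤ N),
      sand k V m (annih k V N S) 0 ⊓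
          (⨆ i : Fin m,
            Submodule.map
              (TensorPower.cast k V
                (by have := i.isLt; omega : (i : ℕ) + N + (m - (i : ℕ)) = m + N + 0)).toLinearMap
              (sand k V (i : ℕ) (annih k V N S) (m - (i : ℕ)))) ≤
        Submodule.map
          (TensorPower.cast k V (by omega : (m - 1) + N + 1 = m + N + 0)).toLinearMap
          (sand k V (m - 1) (annih k V N S) 1)) :
    ∀ (m : ℕ) (h2 : 2 ≤ m) (hm : m + 1 ≤ N),
      Submodule.map
          (TensorPower.cast k (V →ₗ[k] k)
            (by omega : (m - 1) + N + 1 = m + N + 0)).toLinearMap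
          (sand k (V →ₗ[k] k) (m - 1) S 1) ≤
        sand k (V →ₗ[k] k) m S 0 ⊔
          ⨅ i : Fin m,
            Submodule.map
              (TensorPower.cast k (V →ₗ[k] k)
                (by have := i.isLt; omega :
                  (m - ((i : ℕ) + 1)) + N + ((i : ℕ) + 1) = m + N + 0)).toLinearMap
              (sand k (V →ₗ[k] k) (m - ((i : ℕ) + 1)) S ((i : ℕ) + 1)) := by
  intro m h2 hm
  obtain ⟨Φ, hΦ⟩ := exists_orderIso k V (m + N + 0)
  rw [← Φ.le_iff_le, Φ.map_sup, Φ.map_iInf]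
  simp only [hΦ, annih_cast_sand, annih_sand]
  rw [← OrderDual.ofDual_le_ofDual]
  simp only [ofDual_sup, ofDual_iInf, OrderDual.ofDual_toDual]
  refine le_trans (inf_le_inf_left _ (iSup_le fun j => ?_)) (hyp m h2 hm)
  have hj := j.isLt
  refine le_trans (le_of_eq ?_) (le_iSup _ (⟨m - ((j : ℕ) + 1), by omega⟩ : Fin m))
  exact cast_sand_congr k V N _ _ _ _ _ _ _ _ rfl (by simp only; omega)

end PBW16
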